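/- arXiv:2407.17200 — 2 statements merged into one kernel-verified Lean document; each statement's English description precedes it below -/
import Mathlib

section
/- For every λ > 0 and every y ∈ Y, the map θ ∈ ℝ^d ↦ p_λ(y|θ) := E_Z[p_0(y| θ + λ·Z)], where Z is a standard Gaussian random vector in ℝ^d (law N(0, I_d)), is Lipschitz continuous with Lipschitz constant √d/λ with respect to the Euclidean norm. -/
open MeasureTheory Metric Real
open scoped RealInnerProductSpace

noncomputable section

/-- Density of the Gaussian measure `N(0, σ²·I_d)` on `ℝ^d`. -/
def gaussDensity (d : ℕ) (σ : ℝ) (v : EuclideanSpace ℝ (Fin d)) : ℝ :=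
  (2 * π * σ ^ 2) ^ (-(d : ℝ) / 2) * Real.exp (-‖v‖ ^ 2 / (2 * σ ^ 2))

/-- The Gaussian measure `N(0, σ²·I_d)` on `ℝ^d`. -/
def gaussMeasure (d : ℕ) (σ : ℝ) : Measure (EuclideanSpace ℝ (Fin d)) :=
  volume.withDensity fun v => ENNReal.ofReal (gaussDensity d σ v)

/-- Normal cone `F_y` of the finite set `Y` at the point `y`. -/
def normalCone {d : ℕ} (Y : Finset (EuclideanSpace ℝ (Fin d)))
    (y : EuclideanSpace ℝ (Fin d)) : Set (EuclideanSpace ℝ (Fin d)) :=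
  {θ | ∀ y' ∈ Y, ⟪y', θ⟫ ≤ ⟪y, θ⟫}

/-- Internal cone radius `ρ(θ)`. -/
def coneRadius {d : ℕ} (Y : Finset (EuclideanSpace ℝ (Fin d)))
    (θ : EuclideanSpace ℝ (Fin d)) : ℝ :=
  sSup {r : ℝ | 0 < r ∧ ∀ u ∈ closedBall (0 : EuclideanSpace ℝ (Fin d)) 1,
    ∃ y ∈ Y, θ ∈ normalCone Y y ∧ θ + r • u ∈ normalCone Y y}

/-- Uniform probability measure on the closed Euclidean unit ball of `ℝ^d`. -/
def uniformBall (d : ℕ) : Measure (EuclideanSpace ℝ (Fin d)) :=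
  (volume (closedBall (0 : EuclideanSpace ℝ (Fin d)) 1))⁻¹ •
    volume.restrict (closedBall (0 : EuclideanSpace ℝ (Fin d)) 1)

/-- `p_0(y|θ) = P[θ + ρ(θ)·U ∈ F_y]` for `U` uniform on the closed unit ball. -/
def p0 {d : ℕ} (Y : Finset (EuclideanSpace ℝ (Fin d)))
    (y θ : EuclideanSpace ℝ (Fin d)) : ℝ :=
  (uniformBall d {u | θ + coneRadius Y θ • u ∈ normalCone Y y}).toReal

section GaussianDensity

variable {d : ℕ}

theorem gaussDensity_pos {σ : ℝ} (hσ : 0 < σ) (v : EuclideanSpace ℝ (Fin d)) :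
    0 < gaussDensity d σ v := by
  unfold gaussDensity
  positivity

theorem continuous_gaussDensity (σ : ℝ) : Continuous (gaussDensity d σ) := by
  unfold gaussDensity
  fun_prop

theorem integral_gaussDensity {σ : ℝ} (hσ : 0 < σ) : ∫ v, gaussDensity d σ v = 1 := by
  have hb : 0 < (2 * σ ^ 2)⁻¹ := by positivity
  have hint := GaussianFourier.integral_rexp_neg_mul_sq_norm
    (V := EuclideanSpace ℝ (Fin d)) hb
  have hexp : ∀ v : EuclideanSpace ℝ (Fin d),
      -‖v‖ ^ 2 / (2 * σ ^ 2) = -(2 * σ ^ 2)⁻¹ * ‖v‖ ^ 2 := fun v => by ring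
  have hbase : π / (2 * σ ^ 2)⁻¹ = 2 * π * σ ^ 2 := by field_simp
  simp only [gaussDensity, hexp]
  rw [integral_const_mul, hint, finrank_euclideanSpace_fin, hbase,
    ← rpow_add (by positivity), neg_div, neg_add_cancel, rpow_zero]

theorem integrable_gaussDensity {σ : ℝ} (hσ : 0 < σ) : Integrable (gaussDensity d σ) :=
  .of_integral_ne_zero (by rw [integral_gaussDensity hσ]; exact one_ne_zero)

theorem integral_gaussMeasure {σ : ℝ} (hσ : 0 < σ) (g : EuclideanSpace ℝ (Fin d) → ℝ) :
    ∫ v, g v ∂gaussMeasure d σ = ∫ v, gaussDensity d σ v * g v := by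
  rw [gaussMeasure, integral_withDensity_eq_integral_toReal_smul
    (continuous_gaussDensity σ).measurable.ennreal_ofReal (by simp)]
  simp [(gaussDensity_pos hσ _).le]

/-- The midpoint identity behind the Hellinger affinity of two translated Gaussians. -/
theorem gaussDensity_mul_gaussDensity_add (v h : EuclideanSpace ℝ (Fin d)) :
    gaussDensity d 1 v * gaussDensity d 1 (v + h) =
      (exp (-‖h‖ ^ 2 / 8) * gaussDensity d 1 (v + (2⁻¹ : ℝ) • h)) ^ 2 := by
  have hexp : exp (-‖v‖ ^ 2 / (2 * 1 ^ 2)) * exp (-‖v + h‖ ^ 2 / (2 * 1 ^ 2)) =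
      (exp (-‖h‖ ^ 2 / 8) * exp (-‖v + (2⁻¹ : ℝ) • h‖ ^ 2 / (2 * 1 ^ 2))) ^ 2 := by
    rw [← exp_add, ← exp_add, ← exp_nat_mul, norm_add_sq_real, norm_add_sq_real,
      inner_smul_right, norm_smul]
    norm_num
    ring
  unfold gaussDensity
  linear_combination ((2 * π * 1 ^ 2) ^ (-(d : ℝ) / 2)) ^ 2 * hexp

theorem abs_sub_le_of_mul_eq_sq {p q m c : ℝ} (hp : 0 ≤ p) (hq : 0 ≤ q) (hm : 0 ≤ m)
    (hpq : p * q = m ^ 2) (hc : 0 < c) :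
    |p - q| ≤ (p + q - 2 * m) / (4 * c) + c * (p + q + 2 * m) := by
  have hA : 0 ≤ p + q - 2 * m := by nlinarith [sq_nonneg (p - q)]
  have hsq : |p - q| ^ 2 = (p + q - 2 * m) * (p + q + 2 * m) := by
    rw [sq_abs]; linear_combination 4 * -hpq
  refine abs_le_of_sq_le_sq' ?_ (by positivity) |>.2
  rw [hsq]
  have h4 : (p + q - 2 * m) * (p + q + 2 * m) =
      4 * ((p + q - 2 * m) / (4 * c)) * (c * (p + q + 2 * m)) := by field_simp
  rw [h4]
  nlinarith [sq_nonneg ((p + q - 2 * m) / (4 * c) - c * (p + q + 2 * m))]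

/-- Translating the standard Gaussian by `h` moves it by at most `‖h‖` in `L¹`. -/
theorem integral_abs_gaussDensity_sub_le (h : EuclideanSpace ℝ (Fin d)) :
    ∫ v, |gaussDensity d 1 v - gaussDensity d 1 (v + h)| ≤ ‖h‖ := by
  rcases eq_or_ne h 0 with rfl | hne
  · simp
  have hpos : 0 < ‖h‖ := norm_pos_iff.2 hne
  set c := ‖h‖ / 8 with hc
  have hcpos : 0 < c := by positivity
  set s := exp (-‖h‖ ^ 2 / 8) with hs
  have hp : Integrable (gaussDensity d 1) := integrable_gaussDensity one_pos
  have hq := hp.comp_add_right h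
  have hpq : Integrable fun v => gaussDensity d 1 v + gaussDensity d 1 (v + h) := hp.add hq
  have hm := (hp.comp_add_right ((2⁻¹ : ℝ) • h)).const_mul s
  have hle : ∀ v, |gaussDensity d 1 v - gaussDensity d 1 (v + h)| ≤
      (1 / (4 * c) + c) * (gaussDensity d 1 v + gaussDensity d 1 (v + h)) +
        (2 * c - 1 / (2 * c)) * (s * gaussDensity d 1 (v + (2⁻¹ : ℝ) • h)) := fun v => by
    refine (abs_sub_le_of_mul_eq_sq (m := s * gaussDensity d 1 (v + (2⁻¹ : ℝ) • h))
      (gaussDensity_pos one_pos _).le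
      (gaussDensity_pos one_pos _).le
      (mul_nonneg (exp_pos _).le (gaussDensity_pos one_pos _).le)
      (gaussDensity_mul_gaussDensity_add v h) hcpos).trans_eq ?_
    field_simp
    ring
  refine (integral_mono (hp.sub hq).abs
    ((hpq.const_mul _).add (hm.const_mul _)) hle).trans ?_
  have hval : ∫ v, ((1 / (4 * c) + c) * (gaussDensity d 1 v + gaussDensity d 1 (v + h)) +
      (2 * c - 1 / (2 * c)) * (s * gaussDensity d 1 (v + (2⁻¹ : ℝ) • h))) =
      (1 / (4 * c) + c) * 2 + (2 * c - 1 / (2 * c)) * s := by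
    rw [integral_add (hpq.const_mul _) (hm.const_mul _), integral_const_mul,
      integral_add hp hq, integral_const_mul, integral_const_mul,
      integral_add_right_eq_self (gaussDensity d 1),
      integral_add_right_eq_self (gaussDensity d 1), integral_gaussDensity one_pos]
    ring
  have hs1 : s ≤ 1 := exp_le_one_iff.2 (by nlinarith [sq_nonneg ‖h‖])
  have hs2 : 1 - s ≤ 8 * c ^ 2 := by
    have := add_one_le_exp (-‖h‖ ^ 2 / 8)
    rw [hc]
    linarith
  calc _ = (1 / (4 * c) + c) * 2 + (2 * c - 1 / (2 * c)) * s := hval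
    _ = (1 - s) / (2 * c) + 2 * c * (1 + s) := by field_simp; ring
    _ ≤ 8 * c ^ 2 / (2 * c) + 2 * c * (1 + 1) := by gcongr
    _ = ‖h‖ := by rw [hc]; field_simp; ring

theorem aestronglyMeasurable_continuous_mul_iff {φ g : EuclideanSpace ℝ (Fin d) → ℝ}
    (hφ : Continuous φ) (hpos : ∀ v, 0 < φ v) :
    AEStronglyMeasurable (fun v => φ v * g v) ↔ AEStronglyMeasurable g := by
  refine ⟨fun h => ?_, fun h => hφ.aestronglyMeasurable.mul h⟩
  refine ((hφ.inv₀ fun v => (hpos v).ne').aestronglyMeasurable.mul h).congr ?_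
  exact .of_forall fun v => inv_mul_cancel_left₀ (hpos v).ne' (g v)

/-- No measurability of `g` is needed: if `g` is not a.e. measurable, both integrals vanish. -/
theorem abs_integral_gaussDensity_mul_sub_le (g : EuclideanSpace ℝ (Fin d) → ℝ)
    (hg : ∀ v, |g v| ≤ 1) (h : EuclideanSpace ℝ (Fin d)) :
    |(∫ v, gaussDensity d 1 v * g v) - ∫ v, gaussDensity d 1 (v + h) * g v| ≤ ‖h‖ := by
  have hcont := continuous_gaussDensity (d := d) 1
  have hcont' : Continuous fun v => gaussDensity d 1 (v + h) := by fun_prop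
  have hpos : ∀ v, 0 < gaussDensity d 1 v := gaussDensity_pos one_pos
  by_cases hmeas : AEStronglyMeasurable g
  · have hp : Integrable (gaussDensity d 1) := integrable_gaussDensity one_pos
    have hq := hp.comp_add_right h
    have hbdd : ∀ᵐ v, ‖g v‖ ≤ 1 := .of_forall hg
    rw [← integral_sub (hp.mul_bdd hmeas hbdd) (hq.mul_bdd hmeas hbdd)]
    refine (abs_integral_le_integral_abs.trans ?_).trans (integral_abs_gaussDensity_sub_le h)
    refine integral_mono ((hp.mul_bdd hmeas hbdd).sub (hq.mul_bdd hmeas hbdd)).abs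
      (hp.sub hq).abs fun v => ?_
    simp only [← sub_mul, abs_mul]
    exact mul_le_of_le_one_right (abs_nonneg _) (hg v)
  · rw [integral_non_aestronglyMeasurable, integral_non_aestronglyMeasurable]
    · simp
    · rwa [aestronglyMeasurable_continuous_mul_iff hcont' fun v => hpos (v + h)]
    · rwa [aestronglyMeasurable_continuous_mul_iff hcont hpos]

/-- Gaussian smoothing at scale `r` turns a function bounded by `1` into an
`r⁻¹`-Lipschitz one. -/
theorem abs_integral_gaussMeasure_sub_le (f : EuclideanSpace ℝ (Fin d) → ℝ)
    (hf : ∀ v, |f v| ≤ 1) {r : ℝ} (hr : 0 < r) (θ θ' : EuclideanSpace ℝ (Fin d)) :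
    |(∫ z, f (θ + r • z) ∂gaussMeasure d 1) - ∫ z, f (θ' + r • z) ∂gaussMeasure d 1| ≤
      ‖θ - θ'‖ / r := by
  set h := r⁻¹ • (θ - θ') with hh
  have hnorm : ‖h‖ = ‖θ - θ'‖ / r := by
    rw [hh, norm_smul, norm_inv, norm_of_nonneg hr.le, inv_mul_eq_div]
  have hshift : ∀ z, θ' + r • (z + h) = θ + r • z := fun z => by
    rw [hh, smul_add, smul_inv_smul₀ hr.ne']
    abel
  rw [integral_gaussMeasure one_pos, integral_gaussMeasure one_pos,
    ← integral_add_right_eq_self (fun z => gaussDensity d 1 z * f (θ' + r • z)) h, ← hnorm]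
  simp only [hshift]
  exact abs_integral_gaussDensity_mul_sub_le _ (fun z => hf _) h

end GaussianDensity

theorem uniformBall_le_one {d : ℕ} (s : Set (EuclideanSpace ℝ (Fin d))) :
    uniformBall d s ≤ 1 := by
  calc uniformBall d s ≤ uniformBall d Set.univ := measure_mono (Set.subset_univ s)
    _ ≤ 1 := by
      simp only [uniformBall, Measure.smul_apply, Measure.restrict_apply_univ, smul_eq_mul]
      exact ENNReal.inv_mul_le_one _

theorem abs_p0_le_one {d : ℕ} (Y : Finset (EuclideanSpace ℝ (Fin d)))
    (y θ : EuclideanSpace ℝ (Fin d)) : |p0 Y y θ| ≤ 1 := by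
  rw [p0, abs_of_nonneg ENNReal.toReal_nonneg]
  exact ENNReal.toReal_le_of_le_ofReal zero_le_one
    (by rw [ENNReal.ofReal_one]; exact uniformBall_le_one _)

/-- For every `λ > 0` and `y ∈ Y`, the map `θ ↦ p_λ(y|θ) = E_Z[p_0(y|θ + λZ)]`, with `Z`
standard Gaussian, is `√d/λ`-Lipschitz. -/
theorem statement3 {d : ℕ} (hd : 1 ≤ d) (Y : Finset (EuclideanSpace ℝ (Fin d)))
    (hY : Y.Nonempty) (lam : ℝ) (hlam : 0 < lam)
    (y : EuclideanSpace ℝ (Fin d)) (hy : y ∈ Y) :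
    ∀ θ θ' : EuclideanSpace ℝ (Fin d),
      |(∫ z, p0 Y y (θ + lam • z) ∂(gaussMeasure d 1)) -
          (∫ z, p0 Y y (θ' + lam • z) ∂(gaussMeasure d 1))| ≤
        Real.sqrt d / lam * ‖θ - θ'‖ := by
  intro θ θ'
  refine (abs_integral_gaussMeasure_sub_le (p0 Y y) (abs_p0_le_one Y y) hlam θ θ').trans ?_
  rw [div_mul_eq_mul_div]
  gcongr
  exact le_mul_of_one_le_left (norm_nonneg _) (one_le_sqrt.2 (by exact_mod_cast hd))
end
end

section
/- Let Z be a random vector in ℝ^d with law N(0, (1/d)·I_d), independent of X, and define V_w(λ) := E_X[ P( ‖Z‖₂ > ρ(ψ_w(X))/λ | X ) ]. Then for every λ ∈ (0,1) and every q ∈ (0,1): V_w(λ) ≤ P_X( ρ(ψ_w(X))/√d < λ^q ) + exp( −1/(10·λ^{2(1−q)}) ). -/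
open MeasureTheory Metric Real
open scoped RealInnerProductSpace

noncomputable section

theorem gaussDensity_nonneg (d : ℕ) (σ : ℝ) (v : EuclideanSpace ℝ (Fin d)) :
    0 ≤ gaussDensity d σ v := by
  unfold gaussDensity
  positivity

@[fun_prop]
theorem measurable_gaussDensity (d : ℕ) (σ : ℝ) : Measurable (gaussDensity d σ) := by
  unfold gaussDensity
  fun_prop

/-- The Gaussian integral on `ℝ^d`, as a lower Lebesgue integral. -/
theorem lintegral_exp_neg_mul_sq_norm (d : ℕ) {b : ℝ} (hb : 0 < b) :
    ∫⁻ v : EuclideanSpace ℝ (Fin d), ENNReal.ofReal (Real.exp (-b * ‖v‖ ^ 2)) =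
      ENNReal.ofReal ((π / b) ^ ((d : ℝ) / 2)) := by
  have h := GaussianFourier.integral_rexp_neg_mul_sq_norm (V := EuclideanSpace ℝ (Fin d)) hb
  rw [finrank_euclideanSpace_fin] at h
  rw [← h, ofReal_integral_eq_lintegral_ofReal]
  · apply Integrable.of_integral_ne_zero
    rw [h]
    positivity
  · exact Filter.Eventually.of_forall fun v => (Real.exp_pos _).le

theorem gaussMeasure_univ (d : ℕ) {σ : ℝ} (hσ : 0 < σ) : gaussMeasure d σ Set.univ = 1 := by
  have hσ2 : 0 < 2 * σ ^ 2 := by positivity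
  have hexp (v : EuclideanSpace ℝ (Fin d)) :
      ENNReal.ofReal (gaussDensity d σ v) =
        ENNReal.ofReal ((2 * π * σ ^ 2) ^ (-(d : ℝ) / 2)) *
          ENNReal.ofReal (Real.exp (-(2 * σ ^ 2)⁻¹ * ‖v‖ ^ 2)) := by
    rw [← ENNReal.ofReal_mul (by positivity), gaussDensity]
    congr 3
    field_simp
  rw [gaussMeasure, withDensity_apply _ MeasurableSet.univ, Measure.restrict_univ]
  simp_rw [hexp]
  rw [lintegral_const_mul _ (by fun_prop), lintegral_exp_neg_mul_sq_norm d (by positivity),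
    ← ENNReal.ofReal_mul (by positivity), div_inv_eq_mul,
    show π * (2 * σ ^ 2) = 2 * π * σ ^ 2 by ring, ← Real.rpow_add (by positivity)]
  ring_nf
  simp

/-- Translation along a unit vector bounds the Gaussian measure of a half-space. -/
theorem gaussMeasure_halfSpace_le {d : ℕ} (σ : ℝ) {t : ℝ} (ht : 0 ≤ t)
    {e : EuclideanSpace ℝ (Fin d)} (he : ‖e‖ = 1) :
    gaussMeasure d σ {v | t < ⟪e, v⟫} ≤
      ENNReal.ofReal (Real.exp (-t ^ 2 / (2 * σ ^ 2))) * gaussMeasure d σ {v | 0 < ⟪e, v⟫} := by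
  have hmeas (s : ℝ) : MeasurableSet {v : EuclideanSpace ℝ (Fin d) | s < ⟪e, v⟫} :=
    measurableSet_lt (by fun_prop) (by fun_prop)
  rw [gaussMeasure, withDensity_apply _ (hmeas t), withDensity_apply _ (hmeas 0),
    ← lintegral_indicator (hmeas t), ← lintegral_indicator (hmeas 0),
    ← lintegral_const_mul _ (Measurable.indicator (by fun_prop) (hmeas 0)),
    ← lintegral_add_right_eq_self _ (t • e)]
  refine lintegral_mono fun v => ?_
  have hee : ⟪e, e⟫ = 1 := by rw [real_inner_self_eq_norm_sq, he, one_pow]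
  have hinner : ⟪e, v + t • e⟫ = ⟪e, v⟫ + t := by
    rw [inner_add_right, inner_smul_right, hee, mul_one]
  by_cases hv : 0 < ⟪e, v⟫
  · rw [Set.indicator_of_mem (by simpa [hinner] using hv),
      Set.indicator_of_mem (by simpa using hv), ← ENNReal.ofReal_mul (Real.exp_pos _).le]
    apply ENNReal.ofReal_le_ofReal
    have hnorm : ‖v‖ ^ 2 + t ^ 2 ≤ ‖v + t • e‖ ^ 2 := by
      rw [norm_add_sq_real, inner_smul_right, real_inner_comm, norm_smul, he, mul_one,
        Real.norm_eq_abs, sq_abs]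
      nlinarith [mul_nonneg ht hv.le]
    unfold gaussDensity
    rw [mul_left_comm, ← Real.exp_add, ← add_div]
    gcongr
    linarith
  · rw [Set.indicator_of_notMem (by simpa [hinner] using hv)]
    exact zero_le

theorem gaussMeasure_norm_tail_one {σ : ℝ} (hσ : 0 < σ) {t : ℝ} (ht : 0 ≤ t) :
    gaussMeasure 1 σ {v | t < ‖v‖} ≤ ENNReal.ofReal (Real.exp (-t ^ 2 / (2 * σ ^ 2))) := by
  set e : EuclideanSpace ℝ (Fin 1) := EuclideanSpace.single 0 1 with he_def
  have he : ‖e‖ = 1 := by simp [he_def]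
  have hsub : {v : EuclideanSpace ℝ (Fin 1) | t < ‖v‖} ⊆
      {v | t < ⟪e, v⟫} ∪ {v | t < ⟪-e, v⟫} := by
    intro v hv
    have hnorm : ‖v‖ = |v 0| := by simp [EuclideanSpace.norm_eq, Real.sqrt_sq_eq_abs]
    rw [Set.mem_ofPred_eq, hnorm, lt_abs] at hv
    simpa [he_def, EuclideanSpace.inner_single_left] using hv
  have hdisj : Disjoint {v : EuclideanSpace ℝ (Fin 1) | 0 < ⟪e, v⟫} {v | 0 < ⟪-e, v⟫} := by
    rw [Set.disjoint_left]
    intro v hv hv'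
    rw [Set.mem_ofPred_eq] at hv hv'
    rw [inner_neg_left] at hv'
    linarith
  calc gaussMeasure 1 σ {v | t < ‖v‖}
      ≤ gaussMeasure 1 σ {v | t < ⟪e, v⟫} + gaussMeasure 1 σ {v | t < ⟪-e, v⟫} :=
        (measure_mono hsub).trans (measure_union_le _ _)
    _ ≤ ENNReal.ofReal (Real.exp (-t ^ 2 / (2 * σ ^ 2))) *
          (gaussMeasure 1 σ {v | 0 < ⟪e, v⟫} + gaussMeasure 1 σ {v | 0 < ⟪-e, v⟫}) := by
        rw [mul_add]
        exact add_le_add (gaussMeasure_halfSpace_le σ ht he)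
          (gaussMeasure_halfSpace_le σ ht (by rw [norm_neg, he]))
    _ ≤ ENNReal.ofReal (Real.exp (-t ^ 2 / (2 * σ ^ 2))) * 1 := by
        gcongr
        rw [← measure_union hdisj (measurableSet_lt (by fun_prop) (by fun_prop)),
          ← gaussMeasure_univ 1 hσ]
        exact measure_mono (Set.subset_univ _)
    _ = ENNReal.ofReal (Real.exp (-t ^ 2 / (2 * σ ^ 2))) := mul_one _

/-- Chernoff bound for the norm of a Gaussian vector. -/
theorem gaussMeasure_norm_tail (d : ℕ) {σ : ℝ} (hσ : 0 < σ) {R : ℝ} (hR : 0 ≤ R) :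
    gaussMeasure d σ {v | R < ‖v‖} ≤
      ENNReal.ofReal (2 ^ ((d : ℝ) / 2) * Real.exp (-R ^ 2 / (4 * σ ^ 2))) := by
  have hmeas : MeasurableSet {v : EuclideanSpace ℝ (Fin d) | R < ‖v‖} :=
    measurableSet_lt (by fun_prop) (by fun_prop)
  set c : ℝ := (2 * π * σ ^ 2) ^ (-(d : ℝ) / 2) * Real.exp (-R ^ 2 / (4 * σ ^ 2)) with hc
  have hc0 : 0 ≤ c := by positivity
  rw [gaussMeasure, withDensity_apply _ hmeas]
  calc ∫⁻ v in {v | R < ‖v‖}, ENNReal.ofReal (gaussDensity d σ v)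
      ≤ ∫⁻ v in {v : EuclideanSpace ℝ (Fin d) | R < ‖v‖},
          ENNReal.ofReal c * ENNReal.ofReal (Real.exp (-(4 * σ ^ 2)⁻¹ * ‖v‖ ^ 2)) := by
        refine setLIntegral_mono (by fun_prop) fun v hv => ?_
        rw [← ENNReal.ofReal_mul hc0]
        apply ENNReal.ofReal_le_ofReal
        rw [gaussDensity, hc, mul_assoc (_ ^ (-(d : ℝ) / 2)), ← Real.exp_add]
        gcongr
        have hRv : R ^ 2 ≤ ‖v‖ ^ 2 := pow_le_pow_left₀ hR (le_of_lt hv) 2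
        field_simp
        linarith
    _ ≤ ∫⁻ v : EuclideanSpace ℝ (Fin d),
          ENNReal.ofReal c * ENNReal.ofReal (Real.exp (-(4 * σ ^ 2)⁻¹ * ‖v‖ ^ 2)) :=
        setLIntegral_le_lintegral _ _
    _ = ENNReal.ofReal (2 ^ ((d : ℝ) / 2) * Real.exp (-R ^ 2 / (4 * σ ^ 2))) := by
        rw [lintegral_const_mul _ (by fun_prop), lintegral_exp_neg_mul_sq_norm d (by positivity),
          ← ENNReal.ofReal_mul hc0, hc, div_inv_eq_mul,
          show π * (4 * σ ^ 2) = 2 * (2 * π * σ ^ 2) by ring,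
          Real.mul_rpow (x := 2) (by positivity) (by positivity), neg_div,
          Real.rpow_neg (by positivity)]
        congr 1
        field_simp

/-- Norm tail of `N(0, (1/d)·I_d)` beyond `√d · t`, for `t ≥ 1`. -/
theorem gaussMeasure_norm_tail_sqrt {d : ℕ} (hd : 1 ≤ d) {t : ℝ} (ht : 1 ≤ t) :
    gaussMeasure d (√d)⁻¹ {v | √d * t < ‖v‖} ≤ ENNReal.ofReal (Real.exp (-t ^ 2 / 10)) := by
  have hd0 : (0 : ℝ) < d := by exact_mod_cast hd
  have hsq : √(d : ℝ) ^ 2 = d := Real.sq_sqrt hd0.le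
  have hσ : 0 < (√(d : ℝ))⁻¹ := by positivity
  rcases hd.eq_or_lt with rfl | hd2
  · refine (gaussMeasure_norm_tail_one hσ (by positivity)).trans ?_
    apply ENNReal.ofReal_le_ofReal
    apply Real.exp_le_exp.2
    norm_num
    nlinarith [sq_nonneg t]
  · refine (gaussMeasure_norm_tail d hσ (by positivity)).trans ?_
    apply ENNReal.ofReal_le_ofReal
    rw [Real.rpow_def_of_pos two_pos, ← Real.exp_add]
    apply Real.exp_le_exp.2
    have hd2' : (2 : ℝ) ≤ d := by exact_mod_cast hd2
    have hR : -(√(d : ℝ) * t) ^ 2 / (4 * (√(d : ℝ))⁻¹ ^ 2) = -(d ^ 2 * t ^ 2 / 4) := by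
      rw [inv_pow, mul_pow, hsq]
      field_simp
    rw [hR]
    have hlog : Real.log 2 * (d / 2) ≤ 0.7 * (d / 2) := by
      gcongr
      linarith [Real.log_two_lt_d9]
    have ht2 : 1 ≤ t ^ 2 := one_le_pow₀ ht
    have hdt : 2 * d * t ^ 2 ≤ d ^ 2 * t ^ 2 := by
      gcongr
      nlinarith
    nlinarith [mul_nonneg (sub_nonneg.2 hd2') (sub_nonneg.2 ht2)]

/-- Tail bound for `V_w(λ) = E_X[P(‖Z‖ > ρ(ψ_w(X))/λ | X)]` with `Z ~ N(0,(1/d)·I_d)`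
independent of `X`: for `λ, q ∈ (0,1)`,
`V_w(λ) ≤ P_X(ρ(ψ_w(X))/√d < λ^q) + exp(−1/(10·λ^{2(1−q)}))`. -/
theorem statement13 {d : ℕ} (hd : 1 ≤ d) (Y : Finset (EuclideanSpace ℝ (Fin d)))
    (hY : Y.Nonempty)
    {𝒳 : Type*} [MeasurableSpace 𝒳] (μ : Measure 𝒳) [IsProbabilityMeasure μ]
    (ψ : 𝒳 → EuclideanSpace ℝ (Fin d)) (hψ : Measurable ψ)
    (lam q : ℝ) (hlam : lam ∈ Set.Ioo (0 : ℝ) 1) (hq : q ∈ Set.Ioo (0 : ℝ) 1) :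
    (∫ x, (gaussMeasure d (Real.sqrt d)⁻¹
        {z | coneRadius Y (ψ x) / lam < ‖z‖}).toReal ∂μ) ≤
      (μ {x | coneRadius Y (ψ x) / Real.sqrt d < lam ^ q}).toReal +
        Real.exp (-1 / (10 * lam ^ (2 * (1 - q)))) := by
  obtain ⟨hlam0, hlam1⟩ := hlam
  have hd0 : (0 : ℝ) < d := by exact_mod_cast hd
  have hsqrt : 0 < √(d : ℝ) := by positivity
  have hσ : 0 < (√(d : ℝ))⁻¹ := by positivity
  set t : ℝ := lam ^ (q - 1) with ht_def
  have ht : 1 ≤ t := Real.one_le_rpow_of_pos_of_le_one_of_nonpos hlam0 hlam1.le (by linarith [hq.2])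
  have ht2 : -1 / (10 * lam ^ (2 * (1 - q))) = -t ^ 2 / 10 := by
    have h : lam ^ (2 * (1 - q)) = (t ^ 2)⁻¹ := by
      rw [ht_def, ← Real.rpow_natCast, ← Real.rpow_mul hlam0.le, ← Real.rpow_neg hlam0.le]
      congr 1
      push_cast
      ring
    rw [h]
    field_simp
  rw [ht2]
  set A : Set 𝒳 := {x | coneRadius Y (ψ x) / √d < lam ^ q} with hA
  have hmeas : MeasurableSet (toMeasurable μ A) := measurableSet_toMeasurable μ A
  have hint : Integrable ((toMeasurable μ A).indicator fun _ => (1 : ℝ)) μ :=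
    (integrable_const 1).indicator hmeas
  calc ∫ x, (gaussMeasure d (√d)⁻¹ {z | coneRadius Y (ψ x) / lam < ‖z‖}).toReal ∂μ
      ≤ ∫ x, ((toMeasurable μ A).indicator (fun _ => (1 : ℝ)) x + Real.exp (-t ^ 2 / 10)) ∂μ := by
        refine integral_mono_of_nonneg (Filter.Eventually.of_forall fun x => ENNReal.toReal_nonneg)
          (hint.add (integrable_const _)) (Filter.Eventually.of_forall fun x => ?_)
        by_cases hx : x ∈ A
        · have h1 : gaussMeasure d (√d)⁻¹ {z | coneRadius Y (ψ x) / lam < ‖z‖} ≤ 1 := by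
            rw [← gaussMeasure_univ d hσ]
            exact measure_mono (Set.subset_univ _)
          have h2 := ENNReal.toReal_mono ENNReal.one_ne_top h1
          dsimp only
          rw [Set.indicator_of_mem (subset_toMeasurable μ A hx)]
          rw [ENNReal.toReal_one] at h2
          linarith [Real.exp_pos (-t ^ 2 / 10)]
        · have hle : √d * t ≤ coneRadius Y (ψ x) / lam := by
            rw [hA, Set.mem_ofPred_eq, not_lt, le_div_iff₀ hsqrt] at hx
            rw [le_div_iff₀ hlam0, mul_assoc, ht_def, ← Real.rpow_add_one hlam0.ne',
              sub_add_cancel, mul_comm]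
            exact hx
          have h1 : gaussMeasure d (√d)⁻¹ {z | coneRadius Y (ψ x) / lam < ‖z‖} ≤
              ENNReal.ofReal (Real.exp (-t ^ 2 / 10)) :=
            (measure_mono fun z hz => lt_of_le_of_lt hle hz).trans
              (gaussMeasure_norm_tail_sqrt hd ht)
          exact (ENNReal.toReal_le_of_le_ofReal (Real.exp_pos _).le h1).trans
            (le_add_of_nonneg_left (Set.indicator_nonneg (fun _ _ => zero_le_one) x))
    _ = (μ A).toReal + Real.exp (-t ^ 2 / 10) := by
        rw [integral_add hint (integrable_const _), integral_indicator hmeas]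
        simp [Measure.real]
end
end
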